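/- There exists a locally compact, complete geodesic metric space X of curvature ≤ χ for some χ < 0 (in fact, a CAT(χ) space obtained as the union of two hyperbolic cylinders glued along a convex geodesic strip) and a geodesic γ : ℝ → X such that γ is approximated by closed geodesics but γ is not recurrent. Hence, in metric spaces of curvature ≤ χ < 0, approximation by closed geodesics does not imply recurrence. -/

import Mathlib

open Metric Set Filter

/-- `f` restricted to `Set.Icc a b` is a (unit-speed) geodesic segment, i.e. an isometric
embedding of the interval `[a, b]`. -/
def IsGeodesicSegmentOn {X : Type*} [MetricSpace X] (f : ℝ → X) (a b : ℝ) : Prop :=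
  ∀ s ∈ Set.Icc a b, ∀ t ∈ Set.Icc a b, dist (f s) (f t) = |s - t|

/-- A geodesic metric space: any two points are joined by a geodesic segment. -/
def IsGeodesicSpace (X : Type*) [MetricSpace X] : Prop :=
  ∀ x y : X, ∃ f : ℝ → X,
    IsGeodesicSegmentOn f 0 (dist x y) ∧ f 0 = x ∧ f (dist x y) = y

/-- A geodesic (line) in `X`: a map `ℝ → X` whose restriction to every closed interval is a
geodesic segment, equivalently an isometric embedding of `ℝ`. -/
def IsGeodesicLine {X : Type*} [MetricSpace X] (f : ℝ → X) : Prop :=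
  ∀ s t : ℝ, dist (f s) (f t) = |s - t|

/-- A local geodesic `ℝ → X`. -/
def IsLocalGeodesic {X : Type*} [MetricSpace X] (f : ℝ → X) : Prop :=
  ∀ t : ℝ, ∃ ε > 0, IsGeodesicSegmentOn f (t - ε) (t + ε)

/-- A closed geodesic with period `T`: a periodic local geodesic. -/
def IsClosedGeodesic {X : Type*} [MetricSpace X] (f : ℝ → X) (T : ℝ) : Prop :=
  0 < T ∧ Function.Periodic f T ∧ IsLocalGeodesic f

/-- The CAT(χ) comparison inequality (for `χ < 0`) for geodesic triangles contained in `S`.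
Comparison triangles are taken in the model surface of constant curvature `χ`, namely the
hyperbolic plane `ℍ` with distances divided by `√(-χ)`: a configuration
`p' q' r'` in `ℍ` with `dist p' q' = √(-χ) * dist p q` etc. is a comparison triangle, `x'`, `y'`
are comparison points for points `x`, `y` on the sides `[p,q]`, `[p,r]` (membership in a side
being expressed by the betweenness equality for distances), and the CAT(χ) inequality says
`dist x y` is at most the model distance `dist x' y' / √(-χ)`. -/
def CatIneqOn (χ : ℝ) {X : Type*} [MetricSpace X] (S : Set X) : Prop :=
  ∀ p q r x y : X, p ∈ S → q ∈ S → r ∈ S → x ∈ S → y ∈ S →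
    dist p x + dist x q = dist p q →
    dist p y + dist y r = dist p r →
    ∀ p' q' r' x' y' : UpperHalfPlane,
      dist p' q' = Real.sqrt (-χ) * dist p q →
      dist p' r' = Real.sqrt (-χ) * dist p r →
      dist q' r' = Real.sqrt (-χ) * dist q r →
      dist p' x' + dist x' q' = dist p' q' →
      dist p' x' = Real.sqrt (-χ) * dist p x →
      dist p' y' + dist y' r' = dist p' r' →
      dist p' y' = Real.sqrt (-χ) * dist p y →
      Real.sqrt (-χ) * dist x y ≤ dist x' y'

/-- `X` satisfies the CAT(χ) inequality globally. -/
def CatIneq (χ : ℝ) (X : Type*) [MetricSpace X] : Prop :=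
  CatIneqOn χ (Set.univ : Set X)

/-- `X` has curvature `≤ χ` (for `χ < 0`): every point has a neighborhood in which every
geodesic triangle satisfies the CAT(χ) comparison inequality (the perimeter restriction
`2π/√χ` is `+∞` for `χ ≤ 0`). -/
def CurvatureLE (χ : ℝ) (X : Type*) [MetricSpace X] : Prop :=
  ∀ x : X, ∃ ε > 0, CatIneqOn χ (Metric.ball x ε)

/-- A geodesic `γ` is recurrent if there is a sequence `t n → ∞` such that the translates
`s ↦ γ (s + t n)` converge to `γ` uniformly on compact subsets of `ℝ`. -/
def IsRecurrent {X : Type*} [MetricSpace X] (γ : ℝ → X) : Prop :=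
  ∃ t : ℕ → ℝ, Filter.Tendsto t Filter.atTop Filter.atTop ∧
    ∀ K : Set ℝ, IsCompact K →
      TendstoUniformlyOn (fun n s => γ (s + t n)) γ Filter.atTop K

/-- `γ` is approximated by closed geodesics: for every `ε > 0` and every point `γ tx` on its
image there is a closed geodesic `c` of period `T` and a point `c ty` on its image with
`dist (c (t + ty)) (γ (t + tx)) < ε` for all `t ∈ [0, T]`. -/
def ApproximatedByClosedGeodesics {X : Type*} [MetricSpace X] (γ : ℝ → X) : Prop :=
  ∀ ε > 0, ∀ tx : ℝ, ∃ (c : ℝ → X) (T : ℝ), IsClosedGeodesic c T ∧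
    ∃ ty : ℝ, ∀ t ∈ Set.Icc (0 : ℝ) T, dist (c (t + ty)) (γ (t + tx)) < ε

/-- The Gromov four-point inequality implies the CAT(χ) inequality for every `χ`. -/
theorem catIneqOn_of_fourPoint (χ : ℝ) {X : Type*} [MetricSpace X] {S : Set X}
    (h : ∀ x ∈ S, ∀ y ∈ S, ∀ z ∈ S, ∀ w ∈ S,
      dist x y + dist z w ≤ dist x z + dist y w ∨ dist x y + dist z w ≤ dist x w + dist y z) :
    CatIneqOn χ S := by
  intro p q r x y hp hq hr hx hy hpq hpr p' q' r' x' y' hpq' hpr' hqr' hx' hpx' hy' hpy'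
  have key : dist x y ≤ dist p y - dist p x ∨ dist x y ≤ dist p x - dist p y ∨
      dist x y ≤ dist q r - dist x q - dist y r := by
    rw [dist_comm p x, dist_comm p y] at *
    rcases h x hx y hy p hp q hq with h₁ | h₁
    · rcases h y hy q hq p hp r hr with h₂ | h₂
      · right; right; linarith
      · right; left; rw [dist_comm q p] at h₂; linarith
    · left; linarith
  have hc := Real.sqrt_nonneg (-χ)
  have hxq' : dist x' q' = √(-χ) * dist x q := by
    linear_combination hx' - hpx' + hpq' - √(-χ) * hpq
  have hyr' : dist y' r' = √(-χ) * dist y r := by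
    linear_combination hy' - hpy' + hpr' - √(-χ) * hpr
  have h₁ := dist_triangle p' x' y'
  have h₂ := dist_triangle p' y' x'
  have h₃ := dist_triangle4 q' x' y' r'
  rw [dist_comm y' x'] at h₂
  rw [dist_comm q' x'] at h₃
  rcases key with h | h | h <;> have := mul_le_mul_of_nonneg_left h hc <;>
    simp only [mul_sub] at this <;> linarith

theorem abs_sub_fourPoint (a b c d : ℝ) :
    |a - b| + |c - d| ≤ |a - c| + |b - d| ∨ |a - b| + |c - d| ≤ |a - d| + |b - c| := by
  grind

/-- The union of two axes in the `ℓ¹` plane satisfies the four-point inequality. -/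
theorem cross_fourPoint {s₁ s₂ s₃ s₄ t₁ t₂ t₃ t₄ : ℝ} (h₁ : s₁ = 0 ∨ t₁ = 0)
    (h₂ : s₂ = 0 ∨ t₂ = 0) (h₃ : s₃ = 0 ∨ t₃ = 0) (h₄ : s₄ = 0 ∨ t₄ = 0) :
    (|s₁ - s₂| + |t₁ - t₂|) + (|s₃ - s₄| + |t₃ - t₄|) ≤
        (|s₁ - s₃| + |t₁ - t₃|) + (|s₂ - s₄| + |t₂ - t₄|) ∨
      (|s₁ - s₂| + |t₁ - t₂|) + (|s₃ - s₄| + |t₃ - t₄|) ≤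
        (|s₁ - s₄| + |t₁ - t₄|) + (|s₂ - s₃| + |t₂ - t₃|) := by
  have hs := abs_sub_fourPoint s₁ s₂ s₃ s₄
  have ht := abs_sub_fourPoint t₁ t₂ t₃ t₄
  have a₁ := abs_sub s₁ s₂
  have a₂ := abs_sub s₃ s₄
  have b₁ := abs_sub t₁ t₂
  have b₂ := abs_sub t₃ t₄
  rcases h₁ with rfl | rfl <;> rcases h₂ with rfl | rfl <;> rcases h₃ with rfl | rfl <;>
    rcases h₄ with rfl | rfl <;> simp only [sub_zero, zero_sub, abs_neg, abs_zero] at * <;>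
    first
    | (left; linarith)
    | (right; linarith)
    | (rcases hs with hs | hs <;> [left; right] <;> linarith)
    | (rcases ht with ht | ht <;> [left; right] <;> linarith)

theorem UnitAddCircle.coe_add_intCast (a : ℝ) (n : ℤ) :
    ((a + n : ℝ) : UnitAddCircle) = a := by
  simp

theorem UnitAddCircle.norm_coe_of_abs_le {a : ℝ} (h : |a| ≤ 1 / 2) :
    ‖(a : UnitAddCircle)‖ = |a| :=
  (AddCircle.norm_coe_eq_abs_iff 1 one_ne_zero).2 (by simpa using h)

theorem UnitAddCircle.exists_lift (u : UnitAddCircle) :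
    ∃ a : ℝ, (a : UnitAddCircle) = u ∧ |a| = ‖u‖ ∧ |a| ≤ 1 / 2 := by
  induction u using QuotientAddGroup.induction_on with | H a =>
  refine ⟨a - round a, ?_, ?_, abs_sub_round a⟩
  · simp
  · rw [UnitAddCircle.norm_eq]

theorem UnitAddCircle.eq_of_coe_eq_of_abs_sub_lt_one {a b : ℝ} (h : (a : UnitAddCircle) = b)
    (hab : |a - b| < 1) : a = b := by
  have h0 : ((a - b : ℝ) : UnitAddCircle) = 0 := by rw [AddCircle.coe_sub, h, sub_self]
  obtain ⟨n, hn⟩ := (AddCircle.coe_eq_zero_iff 1).1 h0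
  rw [zsmul_one] at hn
  rw [← hn] at hab
  have : n = 0 := Int.abs_lt_one_iff.1 (by exact_mod_cast hab)
  rw [this, Int.cast_zero] at hn
  linarith

/-- Two circles of length one glued at a point, with the length metric. -/
abbrev FigureEight : Type :=
  {x : WithLp 1 (UnitAddCircle × UnitAddCircle) // x.fst = 0 ∨ x.snd = 0}

namespace FigureEight

theorem dist_eq (x y : FigureEight) :
    dist x y = ‖x.1.fst - y.1.fst‖ + ‖x.1.snd - y.1.snd‖ := by
  rw [Subtype.dist_eq, WithLp.prod_dist_eq_of_L1, dist_eq_norm, dist_eq_norm]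

/-- The two circles of the figure eight. -/
def circle (i : Bool) (u : UnitAddCircle) : FigureEight :=
  ⟨WithLp.toLp 1 (if i then (u, 0) else (0, u)), by cases i <;> simp⟩

theorem exists_circle (x : FigureEight) : ∃ i u, circle i u = x := by
  obtain ⟨⟨u, v⟩, h⟩ := x
  rcases h with h | h
  · exact ⟨false, v, Subtype.ext (by simp at h; simp [circle, h])⟩
  · exact ⟨true, u, Subtype.ext (by simp at h; simp [circle, h])⟩

theorem circle_zero (i j : Bool) : circle i 0 = circle j 0 := by
  cases i <;> cases j <;> rfl

theorem dist_circle (i : Bool) (u v : UnitAddCircle) :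
    dist (circle i u) (circle i v) = ‖u - v‖ := by
  cases i <;> simp [dist_eq, circle]

theorem dist_circle_of_ne {i j : Bool} (h : i ≠ j) (u v : UnitAddCircle) :
    dist (circle i u) (circle j v) = ‖u‖ + ‖v‖ := by
  cases i <;> cases j <;> simp_all [dist_eq, circle, add_comm]

instance : CompactSpace FigureEight := by
  have : CompactSpace (WithLp 1 (UnitAddCircle × UnitAddCircle)) :=
    (WithLp.homeomorphProd 1 _ _).symm.compactSpace
  refine isCompact_iff_compactSpace.1 (IsClosed.isCompact ?_)
  have h₁ : Continuous (WithLp.fst : WithLp 1 (UnitAddCircle × UnitAddCircle) → _) := by fun_prop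
  have h₂ : Continuous (WithLp.snd : WithLp 1 (UnitAddCircle × UnitAddCircle) → _) := by fun_prop
  exact (isClosed_eq h₁ continuous_const).union (isClosed_eq h₂ continuous_const)

theorem curvatureLE (χ : ℝ) : CurvatureLE χ FigureEight := by
  intro x
  refine ⟨1 / 8, by norm_num, catIneqOn_of_fourPoint χ ?_⟩
  obtain ⟨s₀, hs₀, -, hs₀'⟩ := UnitAddCircle.exists_lift (-x.1.fst)
  obtain ⟨t₀, ht₀, -, ht₀'⟩ := UnitAddCircle.exists_lift (-x.1.snd)
  have lift (y) (hy : y ∈ ball x (1 / 8)) : ∃ s t : ℝ, (s + s₀ : ℝ) = y.1.fst - x.1.fst ∧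
      (t + t₀ : ℝ) = y.1.snd - x.1.snd ∧ |s + s₀| < 1 / 8 ∧ |t + t₀| < 1 / 8 ∧
      (s = 0 ∨ t = 0) := by
    obtain ⟨s, hs, hsn, -⟩ := UnitAddCircle.exists_lift (y.1.fst - x.1.fst)
    obtain ⟨t, ht, htn, -⟩ := UnitAddCircle.exists_lift (y.1.snd - x.1.snd)
    rw [mem_ball, dist_eq, ← hsn, ← htn] at hy
    have hs1 : |s| < 1 / 8 := by linarith [abs_nonneg t]
    have ht1 : |t| < 1 / 8 := by linarith [abs_nonneg s]
    refine ⟨s - s₀, t - t₀, by simpa using hs, by simpa using ht, by simpa using hs1,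
      by simpa using ht1, ?_⟩
    refine y.2.imp (fun h => ?_) (fun h => ?_)
    · refine sub_eq_zero.2 (UnitAddCircle.eq_of_coe_eq_of_abs_sub_lt_one ?_ ?_)
      · rw [hs, hs₀, h, zero_sub]
      · linarith [abs_sub s s₀]
    · refine sub_eq_zero.2 (UnitAddCircle.eq_of_coe_eq_of_abs_sub_lt_one ?_ ?_)
      · rw [ht, ht₀, h, zero_sub]
      · linarith [abs_sub t t₀]
  have sub (a b c : ℝ) (u v w : UnitAddCircle) (ha : (a + c : ℝ) = u - w)
      (hb : (b + c : ℝ) = v - w) (ha' : |a + c| < 1 / 8) (hb' : |b + c| < 1 / 8) :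
      ‖u - v‖ = |a - b| := by
    rw [← sub_sub_sub_cancel_right u v w, ← ha, ← hb, ← AddCircle.coe_sub,
      add_sub_add_right_eq_sub, UnitAddCircle.norm_coe_of_abs_le]
    rw [← add_sub_add_right_eq_sub a b c]
    linarith [abs_sub (a + c) (b + c)]
  intro y₁ hy₁ y₂ hy₂ y₃ hy₃ y₄ hy₄
  obtain ⟨s₁, t₁, as₁, at₁, bs₁, bt₁, h₁⟩ := lift y₁ hy₁
  obtain ⟨s₂, t₂, as₂, at₂, bs₂, bt₂, h₂⟩ := lift y₂ hy₂
  obtain ⟨s₃, t₃, as₃, at₃, bs₃, bt₃, h₃⟩ := lift y₃ hy₃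
  obtain ⟨s₄, t₄, as₄, at₄, bs₄, bt₄, h₄⟩ := lift y₄ hy₄
  simp only [dist_eq]
  rw [sub s₁ s₂ s₀ _ _ _ as₁ as₂ bs₁ bs₂, sub s₃ s₄ s₀ _ _ _ as₃ as₄ bs₃ bs₄,
    sub s₁ s₃ s₀ _ _ _ as₁ as₃ bs₁ bs₃, sub s₂ s₄ s₀ _ _ _ as₂ as₄ bs₂ bs₄,
    sub s₁ s₄ s₀ _ _ _ as₁ as₄ bs₁ bs₄, sub s₂ s₃ s₀ _ _ _ as₂ as₃ bs₂ bs₃,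
    sub t₁ t₂ t₀ _ _ _ at₁ at₂ bt₁ bt₂, sub t₃ t₄ t₀ _ _ _ at₃ at₄ bt₃ bt₄,
    sub t₁ t₃ t₀ _ _ _ at₁ at₃ bt₁ bt₃, sub t₂ t₄ t₀ _ _ _ at₂ at₄ bt₂ bt₄,
    sub t₁ t₄ t₀ _ _ _ at₁ at₄ bt₁ bt₄, sub t₂ t₃ t₀ _ _ _ at₂ at₃ bt₂ bt₃]
  exact cross_fourPoint h₁ h₂ h₃ h₄

theorem exists_unit_mul_abs (a : ℝ) : ∃ σ : ℝ, |σ| = 1 ∧ |a| * σ = a := by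
  rcases le_total 0 a with h | h
  · exact ⟨1, by simp, by simp [abs_of_nonneg h]⟩
  · exact ⟨-1, by simp, by simp [abs_of_nonpos h]⟩

theorem isGeodesicSpace : IsGeodesicSpace FigureEight := by
  intro x y
  obtain ⟨i, u, rfl⟩ := exists_circle x
  obtain ⟨j, v, rfl⟩ := exists_circle y
  by_cases hij : i = j
  · subst hij
    obtain ⟨a, rfl⟩ := QuotientAddGroup.mk_surjective u
    obtain ⟨b, hb, hbn, hb'⟩ := UnitAddCircle.exists_lift (v - a)
    obtain ⟨σ, hσ, hσb⟩ := exists_unit_mul_abs b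
    have hd : dist (circle i a) (circle i v) = |b| := by
      rw [dist_comm, dist_circle, hbn]
    refine ⟨fun t => circle i ((a + t * σ : ℝ)), ?_, by simp, ?_⟩
    · rw [hd]
      intro s hs t ht
      have e : a + s * σ - (a + t * σ) = (s - t) * σ := by ring
      have hst : |(s - t) * σ| = |s - t| := by rw [abs_mul, hσ, mul_one]
      rw [dist_circle, ← AddCircle.coe_sub, e, UnitAddCircle.norm_coe_of_abs_le, hst]
      rw [hst, abs_le]
      constructor <;> linarith [hs.1, hs.2, ht.1, ht.2]
    · dsimp only
      rw [hd, hσb, AddCircle.coe_add, hb, add_sub_cancel]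
  · obtain ⟨a, ha, han, ha'⟩ := UnitAddCircle.exists_lift u
    obtain ⟨b, hb, hbn, hb'⟩ := UnitAddCircle.exists_lift v
    obtain ⟨σ, hσ, hσa⟩ := exists_unit_mul_abs a
    obtain ⟨τ, hτ, hτb⟩ := exists_unit_mul_abs b
    have hd : dist (circle i u) (circle j v) = |a| + |b| := by
      rw [dist_circle_of_ne hij, han, hbn]
    refine ⟨fun t => if t ≤ |a| then circle i (((|a| - t) * σ : ℝ))
      else circle j (((t - |a|) * τ : ℝ)), ?_, ?_, ?_⟩
    · rw [hd]
      intro s hs t ht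
      wlog hst : s ≤ t generalizing s t
      · rw [dist_comm, abs_sub_comm]
        exact this t ht s hs (le_of_not_ge hst)
      rw [abs_of_nonpos (by linarith : s - t ≤ 0)]
      by_cases h₁ : s ≤ |a| <;> by_cases h₂ : t ≤ |a|
      · have e : |(|a| - s) * σ - (|a| - t) * σ| = t - s := by
          rw [← sub_mul, abs_mul, hσ, mul_one, sub_sub_sub_cancel_left,
            abs_of_nonneg (by linarith)]
        simp only [if_pos h₁, if_pos h₂]
        rw [dist_circle, ← AddCircle.coe_sub, UnitAddCircle.norm_coe_of_abs_le, e]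
        · ring
        · rw [e]; linarith [hs.1]
      · have e : |(|a| - s) * σ| = |a| - s := by
          rw [abs_mul, hσ, mul_one, abs_of_nonneg (by linarith)]
        have e' : |(t - |a|) * τ| = t - |a| := by
          rw [abs_mul, hτ, mul_one, abs_of_nonneg (by linarith)]
        simp only [if_pos h₁, if_neg h₂]
        rw [dist_circle_of_ne hij, UnitAddCircle.norm_coe_of_abs_le,
          UnitAddCircle.norm_coe_of_abs_le, e, e']
        · ring
        · rw [e']; linarith [ht.2]
        · rw [e]; linarith [hs.1]
      · exact absurd (hst.trans h₂) h₁
      · have e : |(s - |a|) * τ - (t - |a|) * τ| = t - s := by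
          rw [← sub_mul, abs_mul, hτ, mul_one, sub_sub_sub_cancel_right,
            abs_of_nonpos (by linarith), neg_sub]
        simp only [if_neg h₁, if_neg h₂]
        rw [dist_circle, ← AddCircle.coe_sub, UnitAddCircle.norm_coe_of_abs_le, e]
        · ring
        · rw [e]; linarith [ht.2]
    · simp [hσa, ha]
    · rw [hd]
      dsimp only
      by_cases h : |b| = 0
      · rw [abs_eq_zero] at h
        subst h
        simp [← hb, circle_zero i j]
      · have : 0 < |b| := lt_of_le_of_ne (abs_nonneg b) (Ne.symm h)
        rw [if_neg (by linarith), add_sub_cancel_left, hτb, hb]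

/-- The path in the figure eight traversing once, in the time interval `[n, n + 1]`, the circle
labelled by `w n`. -/
noncomputable def wordPath (w : ℤ → Bool) (t : ℝ) : FigureEight := circle (w ⌊t⌋) t

theorem dist_wordPath (w : ℤ → Bool) {s t : ℝ} (h : |s - t| ≤ 1 / 2) :
    dist (wordPath w s) (wordPath w t) = |s - t| := by
  wlog hst : s ≤ t generalizing s t
  · rw [dist_comm, abs_sub_comm]
    exact this (by rwa [abs_sub_comm]) (le_of_not_ge hst)
  by_cases hw : w ⌊s⌋ = w ⌊t⌋
  · rw [wordPath, wordPath, hw, dist_circle, ← AddCircle.coe_sub,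
      UnitAddCircle.norm_coe_of_abs_le h]
  · rw [abs_of_nonpos (by linarith : s - t ≤ 0)] at h ⊢
    have hlt : ⌊s⌋ < ⌊t⌋ := lt_of_le_of_ne (Int.floor_mono hst) fun e => hw (by rw [e])
    have h₁ : s < ⌊t⌋ := Int.floor_lt.1 hlt
    have h₂ : (⌊t⌋ : ℝ) ≤ t := Int.floor_le t
    have hcoe (r : ℝ) (n : ℤ) : (r : UnitAddCircle) = ((r - n : ℝ) : UnitAddCircle) := by
      simpa using UnitAddCircle.coe_add_intCast (r - n) n
    rw [wordPath, wordPath, dist_circle_of_ne hw, hcoe s ⌊t⌋, hcoe t ⌊t⌋,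
      UnitAddCircle.norm_coe_of_abs_le, UnitAddCircle.norm_coe_of_abs_le,
      abs_of_nonpos (by linarith), abs_of_nonneg (by linarith)]
    · ring
    · rw [abs_of_nonneg (by linarith)]; linarith
    · rw [abs_of_nonpos (by linarith)]; linarith

theorem isLocalGeodesic_wordPath (w : ℤ → Bool) : IsLocalGeodesic (wordPath w) := by
  refine fun t => ⟨1 / 4, by norm_num, fun r hr s hs => dist_wordPath w (abs_le.2 ?_)⟩
  constructor <;> linarith [hr.1, hr.2, hs.1, hs.2]

theorem isClosedGeodesic_wordPath {w : ℤ → Bool} {k : ℤ} (hk : 0 < k)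
    (hw : Function.Periodic w k) : IsClosedGeodesic (wordPath w) k := by
  refine ⟨by exact_mod_cast hk, fun t => ?_, isLocalGeodesic_wordPath w⟩
  rw [wordPath, wordPath, Int.floor_add_intCast, hw]
  congr 1
  exact UnitAddCircle.coe_add_intCast t k

theorem approximatedByClosedGeodesics_wordPath {w : ℤ → Bool}
    (hw : ∀ n, ∃ k, 0 < k ∧ w (n + k) = w n) :
    ApproximatedByClosedGeodesics (wordPath w) := by
  intro ε hε t₀
  obtain ⟨k, hk, hwk⟩ := hw ⌊t₀⌋
  refine ⟨wordPath fun n => w (⌊t₀⌋ + (n - ⌊t₀⌋) % k), k,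
    isClosedGeodesic_wordPath hk fun n => ?_, t₀, fun t ht => ?_⟩
  · rw [add_sub_right_comm, Int.add_emod_right]
  · have h₁ : ⌊t₀⌋ ≤ ⌊t + t₀⌋ := Int.floor_mono (by linarith [ht.1])
    have h₂ : ⌊t + t₀⌋ ≤ k + ⌊t₀⌋ := by
      rw [← Int.floor_intCast_add]
      exact Int.floor_mono (by linarith [ht.2])
    convert hε
    rw [dist_eq_zero, wordPath, wordPath]
    congr 1
    rcases h₂.lt_or_eq with h | h
    · rw [Int.emod_eq_of_lt (by omega) (by omega), add_sub_cancel]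
    · rw [h, add_sub_cancel_right, Int.emod_self, add_zero, add_comm, hwk]

theorem not_isRecurrent_wordPath {w : ℤ → Bool} (hneg : ∀ n < 0, w n = true)
    (hpos : ∀ n ≥ 0, w (2 * n) = false) : ¬ IsRecurrent (wordPath w) := by
  rintro ⟨t, ht, h⟩
  have h₁ := Metric.tendstoUniformlyOn_iff.1 (h (Icc (-2) 0) isCompact_Icc) (1 / 2) (by norm_num)
  obtain ⟨n, hn, hn'⟩ := (h₁.and (ht.eventually_ge_atTop 1)).exists
  set m : ℤ := ⌊(t n - 1 / 2) / 2⌋ with hm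
  have hm₁ := Int.floor_le ((t n - 1 / 2) / 2)
  have hm₂ := Int.lt_floor_add_one ((t n - 1 / 2) / 2)
  rw [← hm] at hm₁ hm₂
  have hm₀ : 0 ≤ m := Int.floor_nonneg.2 (by linarith)
  specialize hn (2 * m + 1 / 2 - t n) ⟨by linarith, by linarith⟩
  have e₁ : wordPath w (2 * m + 1 / 2 - t n + t n) = circle false ((1 / 2 : ℝ)) := by
    have : ⌊(2 * m + 1 / 2 : ℝ)⌋ = 2 * m := by
      rw [Int.floor_eq_iff]; push_cast; constructor <;> linarith
    rw [sub_add_cancel, wordPath, this, hpos m hm₀]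
    congr 1
    rw [add_comm]
    exact_mod_cast UnitAddCircle.coe_add_intCast (1 / 2) (2 * m)
  have e₂ : ∃ u, wordPath w (2 * m + 1 / 2 - t n) = circle true u := by
    rcases (show (2 * m + 1 / 2 - t n : ℝ) ≤ 0 by linarith).lt_or_eq with h | h
    · exact ⟨_, by rw [wordPath, hneg _ (Int.floor_lt.2 (by simpa using h))]⟩
    · exact ⟨0, by rw [h, wordPath, AddCircle.coe_zero, circle_zero]⟩
  obtain ⟨u, hu⟩ := e₂
  rw [e₁, hu, dist_circle_of_ne (by simp),
    UnitAddCircle.norm_coe_of_abs_le (by norm_num [abs_of_pos])] at hn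
  rw [abs_of_pos (by norm_num)] at hn
  linarith [norm_nonneg u]

end FigureEight

/-- **Counterexample.** There is a locally compact, complete geodesic metric space of curvature
`≤ χ` for some `χ < 0` (in the paper: two hyperbolic cylinders glued along a convex geodesic
strip) and a geodesic `γ : ℝ → X` in it (an element of `GX`, i.e. a local geodesic) which is
approximated by closed geodesics but is not recurrent. -/
theorem approximation_does_not_imply_recurrence :
    ∃ (X : Type) (_ : MetricSpace X),
      LocallyCompactSpace X ∧ CompleteSpace X ∧ IsGeodesicSpace X ∧
      ∃ χ : ℝ, χ < 0 ∧ CurvatureLE χ X ∧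
        ∃ γ : ℝ → X, IsLocalGeodesic γ ∧
          ApproximatedByClosedGeodesics γ ∧ ¬ IsRecurrent γ := by
  refine ⟨FigureEight, inferInstance, inferInstance, inferInstance,
    FigureEight.isGeodesicSpace, -1, by norm_num, FigureEight.curvatureLE _,
    FigureEight.wordPath fun n => decide (n < 0 ∨ n % 2 = 1),
    FigureEight.isLocalGeodesic_wordPath _,
    FigureEight.approximatedByClosedGeodesics_wordPath fun n => ?_,
    FigureEight.not_isRecurrent_wordPath (fun n hn => ?_) (fun n hn => ?_)⟩
  · by_cases h : n < -1
    · exact ⟨1, by norm_num, decide_eq_decide.2 (by omega)⟩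
    · exact ⟨2, by norm_num, decide_eq_decide.2 (by omega)⟩
  · simp [hn]
  · exact decide_eq_false (by omega)
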